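/- Define the kernel Ω(w,t) = C e^{−Aw} e^{8A³t} B (a real scalar) and K(x,y,t) = Bᵀ F(x,t)⁻¹ e^{−Aᵀ(y−x)} Cᵀ (a real scalar). Then for every t ∈ ℝ and every x < y, the double integral ∫ₓ^∞ ∫ₓ^∞ K(x,z,t) Ω(z+s,t) Ω(s+y,t) dz ds converges and K solves the Marchenko integral equation K(x,y,t) − Ω(x+y,t) + ∫ₓ^∞ ∫ₓ^∞ K(x,z,t) Ω(z+s,t) Ω(s+y,t) dz ds = 0. -/

import Mathlib

open Matrix MeasureTheory Filter

noncomputable def mexp {p : ℕ} (M : Matrix (Fin p) (Fin p) ℝ) : Matrix (Fin p) (Fin p) ℝ :=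
  ∑' k : ℕ, (k.factorial : ℝ)⁻¹ • M ^ k

def EigPos {p : ℕ} (A : Matrix (Fin p) (Fin p) ℝ) : Prop :=
  ∀ μ ∈ spectrum ℂ (A.map Complex.ofReal), 0 < μ.re

def Observable {p : ℕ} (A : Matrix (Fin p) (Fin p) ℝ) (C : Matrix (Fin 1) (Fin p) ℝ) : Prop :=
  ∀ v : Fin p → ℝ, (∀ r : ℕ, (C * A ^ r) *ᵥ v = 0) → v = 0

def Controllable {p : ℕ} (A : Matrix (Fin p) (Fin p) ℝ) (B : Matrix (Fin p) (Fin 1) ℝ) : Prop :=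
  ∀ v : Fin p → ℝ, (∀ r : ℕ, (Bᵀ * Aᵀ ^ r) *ᵥ v = 0) → v = 0

noncomputable def Qmat {p : ℕ} (A : Matrix (Fin p) (Fin p) ℝ) (C : Matrix (Fin 1) (Fin p) ℝ) :
    Matrix (Fin p) (Fin p) ℝ :=
  Matrix.of fun i j =>
    ∫ s in Set.Ioi (0 : ℝ), (mexp (-(s • Aᵀ)) * (Cᵀ * C) * mexp (-(s • A))) i j

noncomputable def Nmat {p : ℕ} (A : Matrix (Fin p) (Fin p) ℝ) (B : Matrix (Fin p) (Fin 1) ℝ) :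
    Matrix (Fin p) (Fin p) ℝ :=
  Matrix.of fun i j =>
    ∫ s in Set.Ioi (0 : ℝ), (mexp (-(s • A)) * (B * Bᵀ) * mexp (-(s • Aᵀ))) i j

noncomputable def Pmat {p : ℕ} (A : Matrix (Fin p) (Fin p) ℝ) (B : Matrix (Fin p) (Fin 1) ℝ)
    (C : Matrix (Fin 1) (Fin p) ℝ) : Matrix (Fin p) (Fin p) ℝ :=
  Matrix.of fun i j =>
    ∫ s in Set.Ioi (0 : ℝ), (mexp (-(s • A)) * (B * C) * mexp (-(s • A))) i j

noncomputable def Fmat {p : ℕ} (A : Matrix (Fin p) (Fin p) ℝ) (B : Matrix (Fin p) (Fin 1) ℝ)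
    (C : Matrix (Fin 1) (Fin p) ℝ) (x t : ℝ) : Matrix (Fin p) (Fin p) ℝ :=
  mexp ((2 * x) • Aᵀ - (8 * t) • Aᵀ ^ 3) +
    Qmat A C * mexp (-((2 * x) • A) + (8 * t) • A ^ 3) * Nmat A B

noncomputable def Emat {p : ℕ} (A : Matrix (Fin p) (Fin p) ℝ) (B : Matrix (Fin p) (Fin 1) ℝ)
    (C : Matrix (Fin 1) (Fin p) ℝ) (x t : ℝ) : Matrix (Fin p) (Fin p) ℝ :=
  mexp ((2 * x) • A - (8 * t) • A ^ 3) +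
    Pmat A B C * mexp (-((2 * x) • A) + (8 * t) • A ^ 3) * Pmat A B C

noncomputable def uFun {p : ℕ} (A : Matrix (Fin p) (Fin p) ℝ) (B : Matrix (Fin p) (Fin 1) ℝ)
    (C : Matrix (Fin 1) (Fin p) ℝ) (x t : ℝ) : ℝ :=
  -2 * ((Bᵀ * (Fmat A B C x t)⁻¹ * Cᵀ : Matrix (Fin 1) (Fin 1) ℝ) 0 0)

noncomputable def vFun {p : ℕ} (A : Matrix (Fin p) (Fin p) ℝ) (B : Matrix (Fin p) (Fin 1) ℝ)
    (C : Matrix (Fin 1) (Fin p) ℝ) (x t : ℝ) : ℝ :=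
  -2 * ((C * (Emat A B C x t)⁻¹ * B : Matrix (Fin 1) (Fin 1) ℝ) 0 0)

noncomputable def calQ {p : ℕ} (A : Matrix (Fin p) (Fin p) ℝ) (C : Matrix (Fin 1) (Fin p) ℝ)
    (x t : ℝ) : Matrix (Fin p) (Fin p) ℝ :=
  mexp (-(x • Aᵀ)) * mexp ((8 * t) • Aᵀ ^ 3) * Qmat A C * mexp (-(x • A)) * mexp ((8 * t) • A ^ 3)

noncomputable def calN {p : ℕ} (A : Matrix (Fin p) (Fin p) ℝ) (B : Matrix (Fin p) (Fin 1) ℝ)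
    (x : ℝ) : Matrix (Fin p) (Fin p) ℝ :=
  mexp (-(x • A)) * Nmat A B * mexp (-(x • Aᵀ))

noncomputable def Gam {p : ℕ} (A : Matrix (Fin p) (Fin p) ℝ) (B : Matrix (Fin p) (Fin 1) ℝ)
    (C : Matrix (Fin 1) (Fin p) ℝ) (x t : ℝ) : Matrix (Fin p) (Fin p) ℝ :=
  1 + calQ A C x t * calN A B x

noncomputable def Om {p : ℕ} (A : Matrix (Fin p) (Fin p) ℝ) (B : Matrix (Fin p) (Fin 1) ℝ)
    (C : Matrix (Fin 1) (Fin p) ℝ) (w t : ℝ) : ℝ :=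
  ((C * mexp (-(w • A)) * mexp ((8 * t) • A ^ 3) * B : Matrix (Fin 1) (Fin 1) ℝ) 0 0)

noncomputable def Kker {p : ℕ} (A : Matrix (Fin p) (Fin p) ℝ) (B : Matrix (Fin p) (Fin 1) ℝ)
    (C : Matrix (Fin 1) (Fin p) ℝ) (x y t : ℝ) : ℝ :=
  ((Bᵀ * (Fmat A B C x t)⁻¹ * mexp (-((y - x) • Aᵀ)) * Cᵀ : Matrix (Fin 1) (Fin 1) ℝ) 0 0)


theorem mexp_eq {p : ℕ} (M : Matrix (Fin p) (Fin p) ℝ) : mexp M = NormedSpace.exp M := by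
  rw [NormedSpace.exp_eq_tsum ℝ]; rfl

section decay
attribute [local instance] Matrix.linftyOpNormedRing Matrix.linftyOpNormedAlgebra

theorem exp_spec {p : ℕ} (a : Matrix (Fin p) (Fin p) ℂ) (z : ℂ)
    (hz : z ∈ spectrum ℂ (NormedSpace.exp a)) : ∃ μ ∈ spectrum ℂ a, Complex.exp μ = z := by
  rw [← Matrix.spectrum_toLin', ← Module.End.hasEigenvalue_iff_mem_spectrum] at hz
  have hcomm : Commute (toLin' a) (toLin' (NormedSpace.exp a)) := by
    have : Commute a (NormedSpace.exp a) := (Commute.refl a).exp_right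
    unfold Commute SemiconjBy at *
    rw [Module.End.mul_eq_comp, Module.End.mul_eq_comp, ← toLin'_mul, ← toLin'_mul, this]
  set V := Module.End.eigenspace (toLin' (NormedSpace.exp a)) z with hV
  have hinv : ∀ v ∈ V, toLin' a v ∈ V := by
    intro v hv
    rw [hV, Module.End.mem_eigenspace_iff] at *
    have := congrArg (fun f => f v) hcomm.eq
    simp only [Module.End.mul_apply] at this
    rw [← this, hv, map_smul]
  have hnt : Nontrivial V := by
    rw [Submodule.nontrivial_iff_ne_bot]
    exact hz
  obtain ⟨μ, hμ⟩ := Module.End.exists_eigenvalue ((toLin' a).restrict hinv)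
  obtain ⟨v, hv⟩ := hμ.exists_hasEigenvector
  have hv0 : (v : Fin p → ℂ) ≠ 0 := by
    intro h; exact hv.2 (Subtype.ext h)
  have hav : a *ᵥ (v : Fin p → ℂ) = μ • (v : Fin p → ℂ) := by
    have := congrArg Subtype.val hv.apply_eq_smul
    simpa using this
  refine ⟨μ, ?_, ?_⟩
  · rw [← Matrix.spectrum_toLin', ← Module.End.hasEigenvalue_iff_mem_spectrum]
    apply Module.End.hasEigenvalue_of_hasEigenvector (x := (v : Fin p → ℂ))
    exact ⟨Module.End.mem_eigenspace_iff.2 (by simpa using hav), hv0⟩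
  · have hpow : ∀ n : ℕ, (a ^ n) *ᵥ (v : Fin p → ℂ) = μ ^ n • (v : Fin p → ℂ) := by
      intro n
      induction n with
      | zero => simp
      | succ n ih => rw [pow_succ, ← mulVec_mulVec, hav, mulVec_smul, ih, smul_smul, pow_succ, mul_comm]
    have h1 := NormedSpace.exp_series_hasSum_exp' (𝕂 := ℂ) a
    let L : Matrix (Fin p) (Fin p) ℂ →ₗ[ℂ] (Fin p → ℂ) :=
      { toFun := fun M => M *ᵥ (v : Fin p → ℂ)
        map_add' := fun M N => add_mulVec _ _ _
        map_smul' := fun c M => by simp [smul_mulVec] }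
    have hL : Continuous L := by
      show Continuous (fun M : Matrix (Fin p) (Fin p) ℂ => M *ᵥ (v : Fin p → ℂ))
      fun_prop
    have h2 := h1.map L hL
    have h3 := NormedSpace.exp_series_hasSum_exp' (𝕂 := ℂ) μ
    have h4 := h3.smul_const (v : Fin p → ℂ)
    have h5 : (L ∘ fun n : ℕ => ((n.factorial : ℂ)⁻¹) • a ^ n) =
        fun n : ℕ => ((n.factorial : ℂ)⁻¹ • μ ^ n) • (v : Fin p → ℂ) := by
      funext n
      simp only [Function.comp, map_smul]
      show _ • (a ^ n *ᵥ (v : Fin p → ℂ)) = _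
      rw [hpow, smul_assoc]
    rw [h5] at h2
    have h6 := h2.unique h4
    have h7 : NormedSpace.exp a *ᵥ (v : Fin p → ℂ) = z • (v : Fin p → ℂ) := by
      have := Module.End.mem_eigenspace_iff.1 v.2
      simpa using this
    have h8 : z • (v : Fin p → ℂ) = NormedSpace.exp μ • (v : Fin p → ℂ) := by
      rw [← h7]; exact h6
    rw [← Complex.exp_eq_exp_ℂ] at h8
    exact (smul_left_injective ℂ hv0 h8).symm

theorem exists_mpow_lt {p : ℕ} (hp : 0 < p) (a : Matrix (Fin p) (Fin p) ℂ)
    (ha : ∀ μ ∈ spectrum ℂ a, μ.re < 0) :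
    ∃ N : ℕ, 0 < N ∧ ‖NormedSpace.exp a ^ N‖ < 1 := by
  haveI : Nonempty (Fin p) := ⟨⟨0, hp⟩⟩
  have h1 : spectralRadius ℂ (NormedSpace.exp a) < (1 : NNReal) := by
    apply spectrum.spectralRadius_lt_of_forall_lt
    intro z hz
    obtain ⟨μ, hμ, rfl⟩ := exp_spec a z hz
    rw [← NNReal.coe_lt_coe]
    simp [Complex.norm_exp, ha μ hμ]
  have h2 := spectrum.pow_norm_pow_one_div_tendsto_nhds_spectralRadius (NormedSpace.exp a)
  have h3 := (h2.eventually_lt_const h1).and (eventually_gt_atTop 0)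
  obtain ⟨N, hN, hN0⟩ := h3.exists
  refine ⟨N, hN0, ?_⟩
  by_contra! h
  have : (1 : ℝ) ≤ ‖NormedSpace.exp a ^ N‖ ^ (1 / N : ℝ) := Real.one_le_rpow h (by positivity)
  have := ENNReal.ofReal_le_ofReal this
  simp at this hN
  exact absurd hN (not_lt.2 this)

theorem exp_decay {p : ℕ} (hp : 0 < p) (a : Matrix (Fin p) (Fin p) ℂ)
    (ha : ∀ μ ∈ spectrum ℂ a, μ.re < 0) :
    ∃ K b : ℝ, 0 < b ∧ ∀ s : ℝ, 0 ≤ s → ‖NormedSpace.exp (s • a)‖ ≤ K * Real.exp (-b * s) := by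
  haveI : Nonempty (Fin p) := ⟨⟨0, hp⟩⟩
  obtain ⟨N, hN0, hN⟩ := exists_mpow_lt hp a ha
  have hN0' : (0 : ℝ) < N := by exact_mod_cast hN0
  obtain ⟨q, hq1, hq2⟩ := exists_between (max_lt hN one_pos)
  have hq0 : 0 < q := lt_of_le_of_lt (le_max_right _ _) hq1
  have hqN : ‖NormedSpace.exp a ^ N‖ ≤ q := (le_max_left _ _).trans hq1.le
  have hcont : Continuous (fun s : ℝ => NormedSpace.exp (s • a)) :=
    NormedSpace.exp_continuous.comp (by fun_prop)
  obtain ⟨K, hK⟩ := (isCompact_Icc (a := (0 : ℝ)) (b := N)).exists_bound_of_continuousOn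
    hcont.continuousOn
  have hK0 : 0 ≤ K := (norm_nonneg _).trans (hK 0 ⟨le_rfl, hN0'.le⟩)
  have hlog : Real.log q < 0 := Real.log_neg hq0 hq2
  refine ⟨K * Real.exp (-Real.log q), -Real.log q / N, div_pos (by linarith) hN0', ?_⟩
  intro s hs
  set m := ⌊s / N⌋₊ with hm
  have hm1 : (m : ℝ) ≤ s / N := Nat.floor_le (by positivity)
  have hm2 : s / N < m + 1 := Nat.lt_floor_add_one _
  rw [le_div_iff₀ hN0'] at hm1
  rw [div_lt_iff₀ hN0'] at hm2
  have hsplit : NormedSpace.exp (s • a) =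
      NormedSpace.exp ((s - m * N) • a) * (NormedSpace.exp a ^ N) ^ m := by
    rw [← pow_mul, ← Matrix.exp_nsmul, ← Matrix.exp_add_of_commute]
    · congr 1
      rw [← Nat.cast_smul_eq_nsmul ℝ, ← add_smul]
      congr 1
      push_cast
      ring
    · exact ((Commute.refl a).smul_left _).smul_right _
  rw [hsplit]
  calc _ ≤ ‖NormedSpace.exp ((s - m * N) • a)‖ * ‖(NormedSpace.exp a ^ N) ^ m‖ := norm_mul_le _ _
    _ ≤ K * q ^ m := by
      gcongr
      · exact hK _ ⟨by linarith, by linarith⟩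
      · exact (norm_pow_le _ _).trans (by gcongr)
    _ ≤ K * (Real.exp (-Real.log q) * Real.exp (-(-Real.log q / N) * s)) := by
      gcongr
      rw [← Real.exp_add]
      conv_lhs => rw [← Real.exp_log hq0, ← Real.exp_nat_mul]
      apply Real.exp_le_exp.2
      have : s / N < m + 1 := Nat.lt_floor_add_one _
      have e : -(-Real.log q / N) * s = Real.log q * (s / N) := by ring
      rw [e]
      nlinarith
    _ = _ := by ring

theorem real_decay {p : ℕ} (hp : 0 < p) (A : Matrix (Fin p) (Fin p) ℝ) (hA : EigPos A) :
    ∃ K b : ℝ, 0 < b ∧ ∀ s : ℝ, 0 ≤ s → ∀ i j,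
      |mexp (-(s • A)) i j| ≤ K * Real.exp (-b * s) := by
  obtain ⟨K, b, hb, h⟩ := exp_decay hp (-(A.map Complex.ofReal)) (by
    intro μ hμ
    rw [← spectrum.neg_eq, Set.mem_neg] at hμ
    have := hA _ hμ
    simpa using this)
  refine ⟨K, b, hb, fun s hs i j => ?_⟩
  have hmap : (NormedSpace.exp (-(s • A))).map Complex.ofReal =
      NormedSpace.exp (s • (-(A.map Complex.ofReal))) := by
    have := NormedSpace.map_exp (Complex.ofRealHom.mapMatrix (m := Fin p))
      (by 
        show Continuous (fun M : Matrix (Fin p) (Fin p) ℝ => M.map Complex.ofReal)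
        exact Continuous.matrix_map continuous_id Complex.continuous_ofReal) (-(s • A))
    refine Eq.trans this ?_
    congr 1
    ext i j
    simp
  refine le_trans ?_ (h s hs)
  rw [← hmap, mexp_eq]
  set M := (NormedSpace.exp (-(s • A))).map Complex.ofReal with hM
  have : |NormedSpace.exp (-(s • A)) i j| = ‖M i j‖ := by simp [hM]
  rw [this, Matrix.linfty_opNorm_def]
  have h1 : ‖M i j‖₊ ≤ ∑ k, ‖M i k‖₊ :=
    Finset.single_le_sum (f := fun k => ‖M i k‖₊) (fun _ _ => zero_le) (Finset.mem_univ j)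
  have h2 := h1.trans (Finset.le_sup (f := fun i => ∑ k, ‖M i k‖₊) (Finset.mem_univ i))
  exact_mod_cast h2

theorem mexp_cont {p : ℕ} (A : Matrix (Fin p) (Fin p) ℝ) :
    Continuous (fun s : ℝ => mexp (-(s • A))) := by
  simp only [mexp_eq]
  exact NormedSpace.exp_continuous.comp (by fun_prop)

end decay

theorem mexp_transpose {p : ℕ} (M : Matrix (Fin p) (Fin p) ℝ) : mexp Mᵀ = (mexp M)ᵀ := by
  rw [mexp_eq, mexp_eq, Matrix.exp_transpose]

theorem mexp_neg_transpose {p : ℕ} (A : Matrix (Fin p) (Fin p) ℝ) (s : ℝ) :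
    mexp (-(s • Aᵀ)) = (mexp (-(s • A)))ᵀ := by
  rw [← mexp_transpose]; simp

theorem mexp_add {p : ℕ} {M N : Matrix (Fin p) (Fin p) ℝ} (h : Commute M N) :
    mexp (M + N) = mexp M * mexp N := by
  simp only [mexp_eq]; exact Matrix.exp_add_of_commute _ _ h

theorem entry_int {p : ℕ} (hp : 0 < p) (A : Matrix (Fin p) (Fin p) ℝ) (hA : EigPos A)
    (i j k l : Fin p) :
    IntegrableOn (fun s : ℝ => mexp (-(s • A)) i j * mexp (-(s • A)) k l) (Set.Ioi 0) := by
  obtain ⟨K, b, hb, h⟩ := real_decay hp A hA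
  have hc := mexp_cont A
  apply integrable_of_isBigO_exp_neg (b := 2 * b) (by positivity)
  · exact ((hc.matrix_elem i j).mul (hc.matrix_elem k l)).continuousOn
  · apply Asymptotics.IsBigO.of_bound (K * K)
    filter_upwards [eventually_ge_atTop 0] with s hs
    rw [Real.norm_eq_abs, abs_mul, Real.norm_eq_abs, abs_of_pos (Real.exp_pos _)]
    have e : K * K * Real.exp (-(2 * b) * s) =
      (K * Real.exp (-b * s)) * (K * Real.exp (-b * s)) := by
      have : -(2 * b) * s = -b * s + -b * s := by ring
      rw [this, Real.exp_add]; ring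
    rw [e]
    exact mul_le_mul (h s hs i j) (h s hs k l) (abs_nonneg _) ((abs_nonneg _).trans (h s hs i j))

theorem U_int {p : ℕ} (hp : 0 < p) (A : Matrix (Fin p) (Fin p) ℝ) (hA : EigPos A)
    (M : Matrix (Fin p) (Fin p) ℝ) (i j : Fin p) :
    IntegrableOn (fun s : ℝ => (mexp (-(s • Aᵀ)) * M * mexp (-(s • A))) i j) (Set.Ioi 0) := by
  simp only [mexp_neg_transpose, Matrix.mul_apply, Finset.sum_mul, Matrix.transpose_apply]
  refine integrable_finsetSum _ fun k _ => integrable_finsetSum _ fun l _ => ?_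
  refine ((entry_int hp A hA l i k j).mul_const (M l k)).congr (ae_of_all _ fun s => ?_)
  simp only; ring

theorem V_int {p : ℕ} (hp : 0 < p) (A : Matrix (Fin p) (Fin p) ℝ) (hA : EigPos A)
    (M : Matrix (Fin p) (Fin p) ℝ) (i j : Fin p) :
    IntegrableOn (fun s : ℝ => (mexp (-(s • A)) * M * mexp (-(s • Aᵀ))) i j) (Set.Ioi 0) := by
  simp only [mexp_neg_transpose, Matrix.mul_apply, Finset.sum_mul, Matrix.transpose_apply]
  refine integrable_finsetSum _ fun k _ => integrable_finsetSum _ fun l _ => ?_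
  refine ((entry_int hp A hA i l j k).mul_const (M l k)).congr (ae_of_all _ fun s => ?_)
  simp only; ring

theorem psd_of_int {p : ℕ} (W : ℝ → Matrix (Fin p) (Fin p) ℝ)
    (hW : ∀ i j, IntegrableOn (fun s => W s i j) (Set.Ioi 0))
    (hpsd : ∀ s, (W s).PosSemidef) :
    (Matrix.of fun i j => ∫ s in Set.Ioi (0 : ℝ), W s i j).PosSemidef := by
  apply Matrix.PosSemidef.of_dotProduct_mulVec_nonneg
  · ext i j
    simp only [conjTranspose_apply, of_apply, star_trivial]
    congr 1
    funext s
    have := (hpsd s).1.apply i j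
    simpa using this
  · intro v
    have e : star v ⬝ᵥ ((Matrix.of fun i j => ∫ s in Set.Ioi (0 : ℝ), W s i j) *ᵥ v) =
        ∫ s in Set.Ioi (0 : ℝ), star v ⬝ᵥ (W s *ᵥ v) := by
      simp only [dotProduct, mulVec, of_apply]
      rw [integral_finsetSum]
      · refine Finset.sum_congr rfl fun i _ => ?_
        rw [integral_const_mul, integral_finsetSum]
        · congr 1
          refine Finset.sum_congr rfl fun j _ => ?_
          rw [integral_mul_const]
        · exact fun j _ => (hW i j).mul_const _
      · exact fun i _ => (integrable_finsetSum _ fun j _ => (hW i j).mul_const _).const_mul _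
    rw [e]
    exact integral_nonneg fun s => (hpsd s).dotProduct_mulVec_nonneg v

theorem Q_psd {p : ℕ} (hp : 0 < p) (A : Matrix (Fin p) (Fin p) ℝ) (hA : EigPos A)
    (C : Matrix (Fin 1) (Fin p) ℝ) : (Qmat A C).PosSemidef := by
  apply psd_of_int _ (U_int hp A hA _)
  intro s
  have := Matrix.posSemidef_conjTranspose_mul_self (C * mexp (-(s • A)))
  rw [conjTranspose_eq_transpose_of_trivial, transpose_mul, ← mexp_neg_transpose] at this
  simpa only [Matrix.mul_assoc] using this

theorem N_psd {p : ℕ} (hp : 0 < p) (A : Matrix (Fin p) (Fin p) ℝ) (hA : EigPos A)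
    (B : Matrix (Fin p) (Fin 1) ℝ) : (Nmat A B).PosSemidef := by
  apply psd_of_int _ (V_int hp A hA _)
  intro s
  have := Matrix.posSemidef_self_mul_conjTranspose (mexp (-(s • A)) * B)
  rw [conjTranspose_eq_transpose_of_trivial, transpose_mul, ← mexp_neg_transpose] at this
  simpa only [Matrix.mul_assoc] using this

theorem one_add_unit {p : ℕ} (Q N : Matrix (Fin p) (Fin p) ℝ) (hQ : Q.PosSemidef)
    (hN : N.PosSemidef) : IsUnit (1 + Q * N) := by
  rw [← Matrix.mulVec_injective_iff_isUnit, ← Matrix.coe_mulVecLin, injective_iff_map_eq_zero]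
  intro v hv
  simp only [Matrix.mulVecLin_apply, add_mulVec, one_mulVec, ← mulVec_mulVec] at hv
  have h1 := hN.dotProduct_mulVec_nonneg v
  have h2 := hQ.dotProduct_mulVec_nonneg (N *ᵥ v)
  have h3 : (N *ᵥ v) ⬝ᵥ (v + Q *ᵥ (N *ᵥ v)) = 0 := by rw [hv, dotProduct_zero]
  rw [dotProduct_add, dotProduct_comm _ v] at h3
  simp only [star_trivial] at h1 h2
  have h4 : N *ᵥ v = 0 := (hN.dotProduct_mulVec_zero_iff v).1 (by simp only [star_trivial]; linarith)
  rw [h4, mulVec_zero, add_zero] at hv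
  exact hv

theorem expand {p : ℕ} (L : Matrix (Fin 1) (Fin p) ℝ) (U R V : Matrix (Fin p) (Fin p) ℝ)
    (T : Matrix (Fin p) (Fin 1) ℝ) :
    (L * U * R * V * T) 0 0 =
      ∑ l, ∑ k, ∑ j, ∑ i, (L 0 i * R j k * T l 0) * (U i j * V k l) := by
  simp only [Matrix.mul_apply, Finset.sum_mul]
  refine Finset.sum_congr rfl fun _ _ => Finset.sum_congr rfl fun _ _ =>
    Finset.sum_congr rfl fun _ _ => Finset.sum_congr rfl fun _ _ => ?_
  ring

theorem shift_int {f : ℝ → ℝ} (hf : IntegrableOn f (Set.Ioi 0)) (x : ℝ) :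
    IntegrableOn (fun z => f (z - x)) (Set.Ioi x) := by
  have h := (measurePreserving_sub_right volume x).integrableOn_comp_preimage
    (MeasurableEquiv.subRight x).measurableEmbedding (f := f) (s := Set.Ioi 0)
  have h2 := h.2 hf
  simpa [Function.comp_def] using h2

theorem shift_integral (f : ℝ → ℝ) (x : ℝ) :
    ∫ z in Set.Ioi x, f (z - x) = ∫ z in Set.Ioi 0, f z := by
  have h := (measurePreserving_sub_right volume x).setIntegral_preimage_emb
    (MeasurableEquiv.subRight x).measurableEmbedding f (Set.Ioi 0)
  simpa using h

theorem dbl {p : ℕ} (L : Matrix (Fin 1) (Fin p) ℝ) (U V : ℝ → Matrix (Fin p) (Fin p) ℝ)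
    (R : Matrix (Fin p) (Fin p) ℝ) (T : Matrix (Fin p) (Fin 1) ℝ)
    (hU : ∀ i j, IntegrableOn (fun s => U s i j) (Set.Ioi 0))
    (hV : ∀ i j, IntegrableOn (fun s => V s i j) (Set.Ioi 0)) (x : ℝ) :
    IntegrableOn (fun q : ℝ × ℝ => (L * U (q.1 - x) * R * V (q.2 - x) * T) 0 0)
        (Set.Ioi x ×ˢ Set.Ioi x) ∧
    ∫ z in Set.Ioi x, ∫ s in Set.Ioi x, (L * U (z - x) * R * V (s - x) * T) 0 0 =
      (L * (Matrix.of fun i j => ∫ s in Set.Ioi (0 : ℝ), U s i j) * R *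
        (Matrix.of fun i j => ∫ s in Set.Ioi (0 : ℝ), V s i j) * T) 0 0 := by
  have hU' := fun i j => shift_int (hU i j) x
  have hV' := fun i j => shift_int (hV i j) x
  simp only [expand]
  constructor
  · rw [IntegrableOn, Measure.volume_eq_prod, ← Measure.prod_restrict]
    refine integrable_finsetSum _ fun l _ => integrable_finsetSum _ fun k _ =>
      integrable_finsetSum _ fun j _ => integrable_finsetSum _ fun i _ => ?_
    exact ((hU' i j).mul_prod (hV' k l)).const_mul _
  · have inner : ∀ z, ∫ s in Set.Ioi x, ∑ l, ∑ k, ∑ j, ∑ i,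
        (L 0 i * R j k * T l 0) * (U (z - x) i j * V (s - x) k l) =
        ∑ l, ∑ k, ∑ j, ∑ i, (L 0 i * R j k * T l 0) *
          (U (z - x) i j * ∫ s in Set.Ioi 0, V s k l) := by
      intro z
      have hI : ∀ l k j i, IntegrableOn (fun s => (L 0 i * R j k * T l 0) *
          (U (z - x) i j * V (s - x) k l)) (Set.Ioi x) := fun l k j i =>
        ((hV' k l).const_mul _).const_mul _
      rw [integral_finsetSum _ fun l _ => integrable_finsetSum _ fun k _ =>
        integrable_finsetSum _ fun j _ => integrable_finsetSum _ fun i _ => hI l k j i]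
      refine Finset.sum_congr rfl fun l _ => ?_
      rw [integral_finsetSum _ fun k _ =>
        integrable_finsetSum _ fun j _ => integrable_finsetSum _ fun i _ => hI l k j i]
      refine Finset.sum_congr rfl fun k _ => ?_
      rw [integral_finsetSum _ fun j _ => integrable_finsetSum _ fun i _ => hI l k j i]
      refine Finset.sum_congr rfl fun j _ => ?_
      rw [integral_finsetSum _ fun i _ => hI l k j i]
      refine Finset.sum_congr rfl fun i _ => ?_
      rw [integral_const_mul, integral_const_mul, shift_integral (fun s => V s k l)]
    simp only [inner, of_apply]
    have hI : ∀ l k j i, IntegrableOn (fun z => (L 0 i * R j k * T l 0) *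
          (U (z - x) i j * ∫ s in Set.Ioi 0, V s k l)) (Set.Ioi x) := fun l k j i =>
        ((hU' i j).mul_const _).const_mul _
    rw [integral_finsetSum _ fun l _ => integrable_finsetSum _ fun k _ =>
      integrable_finsetSum _ fun j _ => integrable_finsetSum _ fun i _ => hI l k j i]
    refine Finset.sum_congr rfl fun l _ => ?_
    rw [integral_finsetSum _ fun k _ =>
      integrable_finsetSum _ fun j _ => integrable_finsetSum _ fun i _ => hI l k j i]
    refine Finset.sum_congr rfl fun k _ => ?_
    rw [integral_finsetSum _ fun j _ => integrable_finsetSum _ fun i _ => hI l k j i]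
    refine Finset.sum_congr rfl fun j _ => ?_
    rw [integral_finsetSum _ fun i _ => hI l k j i]
    refine Finset.sum_congr rfl fun i _ => ?_
    rw [integral_const_mul, integral_mul_const, shift_integral (fun s => U s i j)]

theorem mul00 (M N : Matrix (Fin 1) (Fin 1) ℝ) : (M * N) 0 0 = M 0 0 * N 0 0 := by
  simp [Matrix.mul_apply]

theorem tr00 (M : Matrix (Fin 1) (Fin 1) ℝ) : M 0 0 = Mᵀ 0 0 := rfl

theorem E_add {p : ℕ} (A : Matrix (Fin p) (Fin p) ℝ) (s r : ℝ) :
    mexp (-((s + r) • A)) = mexp (-(s • A)) * mexp (-(r • A)) := by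
  rw [← mexp_add]
  · congr 1; rw [add_smul, neg_add]
  · exact (((Commute.refl A).smul_left _).smul_right _).neg_left.neg_right

theorem E_S_comm {p : ℕ} (A : Matrix (Fin p) (Fin p) ℝ) (s r : ℝ) :
    mexp (-(s • A)) * mexp (r • A ^ 3) = mexp (r • A ^ 3) * mexp (-(s • A)) := by
  have h : Commute (-(s • A)) (r • A ^ 3) :=
    ((((Commute.refl A).pow_right 3).smul_left _).smul_right _).neg_left
  rw [← mexp_add h, ← mexp_add h.symm, add_comm]

theorem integrand_eq {p : ℕ} (A : Matrix (Fin p) (Fin p) ℝ)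
    (B : Matrix (Fin p) (Fin 1) ℝ) (C : Matrix (Fin 1) (Fin p) ℝ) (t x y z s : ℝ) :
    Kker A B C x z t * Om A B C (z + s) t * Om A B C (s + y) t =
    ((Bᵀ * (Fmat A B C x t)⁻¹) *
      (mexp (-((z - x) • Aᵀ)) * (Cᵀ * C) * mexp (-((z - x) • A))) *
      (mexp (-((2 * x) • A)) * mexp ((8 * t) • A ^ 3)) *
      (mexp (-((s - x) • A)) * (B * Bᵀ) * mexp (-((s - x) • Aᵀ))) *
      ((mexp (-((x + y) • A)) * mexp ((8 * t) • A ^ 3))ᵀ * Cᵀ) : Matrix (Fin 1) (Fin 1) ℝ) 0 0 := by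
  have h1 : C * mexp (-((z + s) • A)) * mexp ((8 * t) • A ^ 3) * B =
      C * mexp (-((z - x) • A)) * (mexp (-((2 * x) • A)) * mexp ((8 * t) • A ^ 3)) *
        mexp (-((s - x) • A)) * B := by
    have e : z + s = (z - x) + (2 * x + (s - x)) := by ring
    rw [e, E_add, E_add]
    simp only [Matrix.mul_assoc]
    rw [← Matrix.mul_assoc (mexp (-((s - x) • A))), E_S_comm]
    simp only [Matrix.mul_assoc]
  have h2 : (C * mexp (-((s + y) • A)) * mexp ((8 * t) • A ^ 3) * B)ᵀ =
      Bᵀ * mexp (-((s - x) • Aᵀ)) *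
        ((mexp (-((x + y) • A)) * mexp ((8 * t) • A ^ 3))ᵀ * Cᵀ) := by
    have e : s + y = (x + y) + (s - x) := by ring
    rw [mexp_neg_transpose, ← transpose_mul, ← transpose_mul, ← transpose_mul, e, E_add]
    simp only [Matrix.mul_assoc]
    rw [← Matrix.mul_assoc (mexp (-((s - x) • A))), E_S_comm]
    simp only [Matrix.mul_assoc]
  unfold Kker Om
  rw [tr00 (C * mexp (-((s + y) • A)) * mexp ((8 * t) • A ^ 3) * B), h2, h1, ← mul00, ← mul00]
  simp only [Matrix.mul_assoc]

theorem F_alg {p : ℕ} (M Q N : Matrix (Fin p) (Fin p) ℝ) (D : Matrix (Fin p) (Fin p) ℝ)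
    (hD : M * D = 1) (hQ : Q.PosSemidef) (hN : N.PosSemidef) :
    IsUnit (Dᵀ + Q * M * N) := by
  have hD' : Mᵀ * Dᵀ = 1 := by
    rw [← transpose_mul, mul_eq_one_comm.1 hD, transpose_one]
  have hu := one_add_unit (Mᵀ * Q * M) N (by
    simpa using hQ.conjTranspose_mul_mul_same M) hN
  have e : 1 + Mᵀ * Q * M * N = Mᵀ * (Dᵀ + Q * M * N) := by
    rw [Matrix.mul_add, hD']; simp only [Matrix.mul_assoc]
  rw [e] at hu
  rw [Matrix.isUnit_iff_isUnit_det] at hu ⊢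
  rw [det_mul] at hu
  exact isUnit_of_mul_isUnit_right hu

theorem statement18 {p : ℕ} (hp : 0 < p) (A : Matrix (Fin p) (Fin p) ℝ)
    (B : Matrix (Fin p) (Fin 1) ℝ) (C : Matrix (Fin 1) (Fin p) ℝ)
    (hA : EigPos A) (hobs : Observable A C) (hctrl : Controllable A B) :
    ∀ t x y : ℝ, x < y →
      IntegrableOn
        (fun q : ℝ × ℝ => Kker A B C x q.1 t * Om A B C (q.1 + q.2) t * Om A B C (q.2 + y) t)
        (Set.Ioi x ×ˢ Set.Ioi x) ∧
      Kker A B C x y t - Om A B C (x + y) t +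
        ∫ z in Set.Ioi x, ∫ s in Set.Ioi x,
          Kker A B C x z t * Om A B C (z + s) t * Om A B C (s + y) t = 0 := by
  intro t x y _
  set M := mexp (-((2 * x) • A)) * mexp ((8 * t) • A ^ 3) with hM
  set D := mexp ((2 * x) • A - (8 * t) • A ^ 3) with hDdef
  have hcomm : Commute (-((2 * x) • A)) ((8 * t) • A ^ 3) :=
    ((((Commute.refl A).pow_right 3).smul_left _).smul_right _).neg_left
  have hM' : mexp (-((2 * x) • A) + (8 * t) • A ^ 3) = M := mexp_add hcomm
  have hD : M * D = 1 := by
    rw [← hM', hDdef]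
    have e : (2 * x) • A - (8 * t) • A ^ 3 = -(-((2 * x) • A) + (8 * t) • A ^ 3) := by abel
    rw [e, ← mexp_add (Commute.refl _).neg_right, add_neg_cancel, mexp_eq, NormedSpace.exp_zero]
  have hF : Fmat A B C x t = Dᵀ + Qmat A C * M * Nmat A B := by
    unfold Fmat
    rw [hM', hDdef, ← mexp_transpose]
    simp [transpose_pow]
  have hunit : IsUnit (Fmat A B C x t) := by
    rw [hF]; exact F_alg M _ _ D hD (Q_psd hp A hA C) (N_psd hp A hA B)
  have hinv : (Fmat A B C x t)⁻¹ * Fmat A B C x t = 1 :=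
    Matrix.nonsing_inv_mul _ ((Matrix.isUnit_iff_isUnit_det _).1 hunit)
  obtain ⟨h1, h2⟩ := dbl (Bᵀ * (Fmat A B C x t)⁻¹)
    (fun z => mexp (-(z • Aᵀ)) * (Cᵀ * C) * mexp (-(z • A)))
    (fun s => mexp (-(s • A)) * (B * Bᵀ) * mexp (-(s • Aᵀ))) M
    ((mexp (-((x + y) • A)) * mexp ((8 * t) • A ^ 3))ᵀ * Cᵀ)
    (U_int hp A hA _) (V_int hp A hA _) x
  simp only [integrand_eq]
  refine ⟨h1, ?_⟩
  rw [h2]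
  change Kker A B C x y t - Om A B C (x + y) t + (Bᵀ * (Fmat A B C x t)⁻¹ * Qmat A C * M * Nmat A B *
    ((mexp (-((x + y) • A)) * mexp ((8 * t) • A ^ 3))ᵀ * Cᵀ) : Matrix (Fin 1) (Fin 1) ℝ) 0 0 = 0
  have hK : Kker A B C x y t = (Bᵀ * (Fmat A B C x t)⁻¹ * Dᵀ *
    ((mexp (-((x + y) • A)) * mexp ((8 * t) • A ^ 3))ᵀ * Cᵀ) : Matrix (Fin 1) (Fin 1) ℝ) 0 0 := by
    have e : mexp (-((x + y) • A)) * mexp ((8 * t) • A ^ 3) * D = mexp (-((y - x) • A)) := by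
      have : x + y = (y - x) + 2 * x := by ring
      rw [this, E_add, Matrix.mul_assoc, Matrix.mul_assoc, ← Matrix.mul_assoc _ _ D, ← hM, hD,
        Matrix.mul_one]
    unfold Kker
    rw [mexp_neg_transpose, ← e, transpose_mul]
    simp only [Matrix.mul_assoc]
  have hO : Om A B C (x + y) t =
      (Bᵀ * ((mexp (-((x + y) • A)) * mexp ((8 * t) • A ^ 3))ᵀ * Cᵀ) : Matrix (Fin 1) (Fin 1) ℝ) 0 0 := by
    unfold Om
    rw [tr00 (C * mexp (-((x + y) • A)) * mexp ((8 * t) • A ^ 3) * B)]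
    simp only [transpose_mul, Matrix.mul_assoc]
  have hsum : ∀ T : Matrix (Fin p) (Fin 1) ℝ, Bᵀ * (Fmat A B C x t)⁻¹ * Dᵀ * T +
      Bᵀ * (Fmat A B C x t)⁻¹ * Qmat A C * M * Nmat A B * T = Bᵀ * T := by
    intro T
    calc _ = Bᵀ * ((Fmat A B C x t)⁻¹ * (Dᵀ + Qmat A C * M * Nmat A B)) * T := by
          simp only [Matrix.mul_add, Matrix.add_mul, Matrix.mul_assoc]
      _ = _ := by rw [← hF, hinv, Matrix.mul_one]
  rw [hK, hO, ← hsum, Matrix.add_apply]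
  ring
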